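/- Let C be a finite tensor category. The map W defined on objects of st(Z(C)) by W(X) = V(F̄(X)) = {P ∈ Spc st(C) : F̄(X) ∉ P} is a support datum on st(Z(C)) with values in the topological space Spc st(C), and each W(X) is a closed subset of Spc st(C). -/

import Mathlib

open CategoryTheory Limits Pretriangulated MonoidalCategory ZeroObject

universe v u

namespace TTG

variable (C : Type u) [Category.{v} C] [HasZeroObject C] [Preadditive C]
  [MonoidalCategory C] [HasShift C ℤ] [∀ n : ℤ, (shiftFunctor C n).Additive]
  [Pretriangulated C]

/-- A thick (two-sided, ⊗-)ideal of a monoidal triangulated category, encoded by its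
class of objects. -/
structure ThickIdeal : Type (max u v) where
  mem : C → Prop
  iso_closed : ∀ {X Y : C}, (X ≅ Y) → mem X → mem Y
  zero_mem : mem 0
  shift_mem : ∀ (X : C) (n : ℤ), mem X → mem (X⟦n⟧)
  ext_mem : ∀ T : Triangle C, T ∈ (distTriang C) → mem T.obj₁ → mem T.obj₂ → mem T.obj₃
  retract_mem : ∀ {X Y : C} (i : X ⟶ Y) (r : Y ⟶ X), i ≫ r = 𝟙 X → mem Y → mem X
  tensor_right_mem : ∀ X Y : C, mem X → mem (X ⊗ Y)
  tensor_left_mem : ∀ X Y : C, mem Y → mem (X ⊗ Y)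

variable {C}

/-- A thick ideal `P` is prime if it is proper and `I ⊗ J ⊆ P` implies `I ⊆ P` or `J ⊆ P`
for all thick ideals `I`, `J`. -/
def ThickIdeal.IsPrime (P : ThickIdeal C) : Prop :=
  (∃ X : C, ¬ P.mem X) ∧
  ∀ I J : ThickIdeal C,
    (∀ X Y : C, I.mem X → J.mem Y → P.mem (X ⊗ Y)) →
    (∀ X : C, I.mem X → P.mem X) ∨ (∀ Y : C, J.mem Y → P.mem Y)

variable (C)

/-- The Balmer spectrum: the collection of prime thick ideals. -/
def Spc : Type (max u v) := {P : ThickIdeal C // P.IsPrime}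

/-- The Zariski topology on the Balmer spectrum, whose closed sets are generated by the
Balmer supports `V(A) = {P : A ∉ P}`. -/
instance : TopologicalSpace (Spc C) :=
  TopologicalSpace.generateFrom {U : Set (Spc C) | ∃ X : C, U = {P : Spc C | P.1.mem X}}

/-- The closed set `V(S) = {P ∈ Spc : S ∩ P = ∅}` associated to a collection of objects. -/
def V (S : Set C) : Set (Spc C) := {P : Spc C | ∀ X ∈ S, ¬ P.1.mem X}

/-- The thick ideal generated by a collection of objects. -/
def genIdeal (S : Set C) : ThickIdeal C where
  mem X := ∀ J : ThickIdeal C, (∀ Y ∈ S, J.mem Y) → J.mem X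
  iso_closed := fun e h J hJ => J.iso_closed e (h J hJ)
  zero_mem := fun J _ => J.zero_mem
  shift_mem := fun X n h J hJ => J.shift_mem X n (h J hJ)
  ext_mem := fun T hT h1 h2 J hJ => J.ext_mem T hT (h1 J hJ) (h2 J hJ)
  retract_mem := fun i r hir h J hJ => J.retract_mem i r hir (h J hJ)
  tensor_right_mem := fun X Y h J hJ => J.tensor_right_mem X Y (h J hJ)
  tensor_left_mem := fun X Y h J hJ => J.tensor_left_mem X Y (h J hJ)

/-- (Object-level) exactness of the monoidal product: tensoring a distinguished triangle on
either side by any object again yields a distinguished triangle.  This is the compatibility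
required of a monoidal triangulated category. -/
def TensorExact : Prop :=
  ∀ (X : C) (T : Triangle C), T ∈ (distTriang C) →
    (∃ T' ∈ (distTriang C), Nonempty (T'.obj₁ ≅ X ⊗ T.obj₁) ∧ Nonempty (T'.obj₂ ≅ X ⊗ T.obj₂) ∧
      Nonempty (T'.obj₃ ≅ X ⊗ T.obj₃)) ∧
    (∃ T' ∈ (distTriang C), Nonempty (T'.obj₁ ≅ T.obj₁ ⊗ X) ∧ Nonempty (T'.obj₂ ≅ T.obj₂ ⊗ X) ∧
      Nonempty (T'.obj₃ ≅ T.obj₃ ⊗ X))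

end TTG

namespace TTG

variable (C : Type u) [Category.{v} C] [HasZeroObject C] [Preadditive C]
  [MonoidalCategory C] [HasShift C ℤ] [∀ n : ℤ, (shiftFunctor C n).Additive]
  [Pretriangulated C]
variable (D : Type u) [Category.{v} D] [HasZeroObject D] [Preadditive D]
  [MonoidalCategory D] [HasShift D ℤ] [∀ n : ℤ, (shiftFunctor D n).Additive]
  [Pretriangulated D]

/-- A monoidal triangulated (i.e. exact monoidal) functor between monoidal triangulated
categories. -/
structure MTFunctor where
  toFun : C ⥤ D
  additive : toFun.Additive
  unit_iso : Nonempty (toFun.obj (𝟙_ C) ≅ 𝟙_ D)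
  tensor_iso : ∀ X Y : C, Nonempty (toFun.obj (X ⊗ Y) ≅ toFun.obj X ⊗ toFun.obj Y)
  shift_iso : ∀ (X : C) (n : ℤ), Nonempty (toFun.obj (X⟦n⟧) ≅ (toFun.obj X)⟦n⟧)
  zero_iso : IsZero (toFun.obj 0)
  maps_dist : ∀ T : Triangle C, T ∈ (distTriang C) → ∃ T' ∈ (distTriang D),
    Nonempty (T'.obj₁ ≅ toFun.obj T.obj₁) ∧ Nonempty (T'.obj₂ ≅ toFun.obj T.obj₂) ∧
    Nonempty (T'.obj₃ ≅ toFun.obj T.obj₃)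

end TTG

namespace TTG

universe u₂

/-- Axiomatization of the stable category of a finite tensor category `A`:
a monoidal triangulated category `S` together with the quotient functor `A ⥤ S`,
which is surjective on objects, full, kills exactly the projective objects, is monoidal,
and sends short exact sequences of `A` to distinguished triangles of `S`. -/
structure StableCategoryData (A : Type u₂) [Category.{v} A] [MonoidalCategory A]
    [Limits.HasZeroMorphisms A]
    (S : Type u) [Category.{v} S] [HasZeroObject S] [Preadditive S] [MonoidalCategory S]
    [HasShift S ℤ] [∀ n : ℤ, (shiftFunctor S n).Additive] [Pretriangulated S] :
    Type (max u u₂ v) where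
  Gq : A ⥤ S
  obj_surj : Function.Surjective Gq.obj
  full : ∀ {X Y : A} (g : Gq.obj X ⟶ Gq.obj Y), ∃ f : X ⟶ Y, Gq.map f = g
  iso_zero_iff_proj : ∀ X : A, IsZero (Gq.obj X) ↔ Projective X
  unit_iso : Nonempty (Gq.obj (𝟙_ A) ≅ 𝟙_ S)
  tensor_iso : ∀ X Y : A, Nonempty (Gq.obj (X ⊗ Y) ≅ Gq.obj X ⊗ Gq.obj Y)
  exact_to_dist : ∀ E : ShortComplex A, E.ShortExact →
    ∃ δ : Gq.obj E.X₃ ⟶ (Gq.obj E.X₁)⟦(1 : ℤ)⟧,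
      Triangle.mk (Gq.map E.f) (Gq.map E.g) δ ∈ (distTriang S)

end TTG

namespace TTG

/-- A class of objects containing the zero object, closed under isomorphisms, and closed under
cones and cocones of morphisms between its members, is closed under all shifts. -/
theorem shift_mem_of_two_of_three {C : Type u} [Category.{v} C] [HasZeroObject C]
    [Preadditive C] [HasShift C ℤ] [∀ n : ℤ, (shiftFunctor C n).Additive] [Pretriangulated C]
    {K : C → Prop} (hiso : ∀ {X Y : C}, (X ≅ Y) → K X → K Y)
    (hzero : K 0)
    (h₃ : ∀ T : Triangle C, T ∈ distTriang C → K T.obj₁ → K T.obj₂ → K T.obj₃)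
    (h₁ : ∀ T : Triangle C, T ∈ distTriang C → K T.obj₂ → K T.obj₃ → K T.obj₁)
    (X : C) (n : ℤ) (hX : K X) : K (X⟦n⟧) := by
  have up (Y : C) (hY : K Y) : K (Y⟦(1 : ℤ)⟧) :=
    h₃ (Triangle.mk (0 : Y ⟶ 0) 0 (𝟙 (Y⟦(1 : ℤ)⟧))) (contractible_distinguished₂ Y) hY hzero
  have down (Y : C) (hY : K (Y⟦(1 : ℤ)⟧)) : K Y :=
    h₁ (Triangle.mk (0 : Y ⟶ 0) 0 (𝟙 (Y⟦(1 : ℤ)⟧)))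
      (contractible_distinguished₂ Y) hzero hY
  induction n using Int.induction_on with
  | zero => exact hiso ((shiftFunctorZero C ℤ).app X).symm hX
  | succ n ih => exact hiso ((shiftFunctorAdd C (n : ℤ) 1).app X).symm (up _ ih)
  | pred n ih =>
    exact down _ (hiso ((shiftFunctorAdd' C (-(n : ℤ) - 1) 1 (-(n : ℤ)) (by lia)).app X) ih)

section MonoidalTriangulated

variable {C : Type u} [Category.{v} C] [HasZeroObject C] [Preadditive C]
  [MonoidalCategory C] [HasShift C ℤ] [∀ n : ℤ, (shiftFunctor C n).Additive]
  [Pretriangulated C]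

namespace ThickIdeal

variable (P : ThickIdeal C)

theorem mem_congr {X Y : C} (e : X ≅ Y) : P.mem X ↔ P.mem Y :=
  ⟨P.iso_closed e, P.iso_closed e.symm⟩

theorem mem_of_isZero {X : C} (h : IsZero X) : P.mem X :=
  P.iso_closed h.isoZero.symm P.zero_mem

theorem shift_mem_iff (X : C) (n : ℤ) : P.mem (X⟦n⟧) ↔ P.mem X :=
  ⟨fun h => P.iso_closed (shiftShiftNeg X n) (P.shift_mem _ (-n) h), P.shift_mem X n⟩

theorem mem_obj₁ (T : Triangle C) (hT : T ∈ distTriang C) (h₂ : P.mem T.obj₂)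
    (h₃ : P.mem T.obj₃) : P.mem T.obj₁ :=
  (P.shift_mem_iff T.obj₁ 1).1 (P.ext_mem T.rotate (rot_of_distTriang T hT) h₂ h₃)

theorem mem_obj₂ (T : Triangle C) (hT : T ∈ distTriang C) (h₁ : P.mem T.obj₁)
    (h₃ : P.mem T.obj₃) : P.mem T.obj₂ :=
  P.ext_mem T.invRotate (inv_rot_of_distTriang T hT) (P.shift_mem _ (-1) h₃) h₁

theorem unit_notMem (hP : P.IsPrime) : ¬ P.mem (𝟙_ C) := by
  obtain ⟨X, hX⟩ := hP.1
  exact fun h => hX (P.iso_closed (λ_ X) (P.tensor_right_mem _ X h))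

end ThickIdeal

/-- The left annihilator modulo `P` of a class of objects that is stable under tensoring
on the left. -/
def leftAnnihilator (hC : TensorExact C) (P : ThickIdeal C) (S : C → Prop)
    (hS : ∀ X Y : C, S Y → S (X ⊗ Y)) : ThickIdeal C where
  mem X := ∀ Y, S Y → P.mem (X ⊗ Y)
  iso_closed e h Y hY := P.iso_closed (whiskerRightIso e Y) (h Y hY)
  zero_mem Y _ := P.tensor_right_mem 0 Y P.zero_mem
  shift_mem X n hX Y hY := by
    refine shift_mem_of_two_of_three (K := fun X => P.mem (X ⊗ Y))
      (fun e => P.iso_closed (whiskerRightIso e Y)) (P.tensor_right_mem 0 Y P.zero_mem)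
      (fun T hT h₁ h₂ => ?_) (fun T hT h₂ h₃ => ?_) X n (hX Y hY)
    all_goals obtain ⟨T', hT', ⟨e₁⟩, ⟨e₂⟩, ⟨e₃⟩⟩ := (hC Y T hT).2
    · exact P.iso_closed e₃ (P.ext_mem T' hT' (P.iso_closed e₁.symm h₁) (P.iso_closed e₂.symm h₂))
    · exact P.iso_closed e₁ (P.mem_obj₁ T' hT' (P.iso_closed e₂.symm h₂) (P.iso_closed e₃.symm h₃))
  ext_mem T hT h₁ h₂ Y hY := by
    obtain ⟨T', hT', ⟨e₁⟩, ⟨e₂⟩, ⟨e₃⟩⟩ := (hC Y T hT).2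
    exact P.iso_closed e₃ (P.ext_mem T' hT' (P.iso_closed e₁.symm (h₁ Y hY))
      (P.iso_closed e₂.symm (h₂ Y hY)))
  retract_mem i r hir h Y hY :=
    P.retract_mem (i ▷ Y) (r ▷ Y) (by rw [← comp_whiskerRight, hir, id_whiskerRight]) (h Y hY)
  tensor_right_mem X Z h Y hY := P.iso_closed (α_ X Z Y).symm (h _ (hS Z Y hY))
  tensor_left_mem Z X h Y hY := P.iso_closed (α_ Z X Y).symm (P.tensor_left_mem _ _ (h Y hY))

/-- The right annihilator modulo `P` of a class of objects that is stable under tensoring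
on the right. -/
def rightAnnihilator (hC : TensorExact C) (P : ThickIdeal C) (S : C → Prop)
    (hS : ∀ X Y : C, S X → S (X ⊗ Y)) : ThickIdeal C where
  mem Y := ∀ X, S X → P.mem (X ⊗ Y)
  iso_closed e h X hX := P.iso_closed (whiskerLeftIso X e) (h X hX)
  zero_mem X _ := P.tensor_left_mem X 0 P.zero_mem
  shift_mem Y n hY X hX := by
    refine shift_mem_of_two_of_three (K := fun Y => P.mem (X ⊗ Y))
      (fun e => P.iso_closed (whiskerLeftIso X e)) (P.tensor_left_mem X 0 P.zero_mem)
      (fun T hT h₁ h₂ => ?_) (fun T hT h₂ h₃ => ?_) Y n (hY X hX)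
    all_goals obtain ⟨T', hT', ⟨e₁⟩, ⟨e₂⟩, ⟨e₃⟩⟩ := (hC X T hT).1
    · exact P.iso_closed e₃ (P.ext_mem T' hT' (P.iso_closed e₁.symm h₁) (P.iso_closed e₂.symm h₂))
    · exact P.iso_closed e₁ (P.mem_obj₁ T' hT' (P.iso_closed e₂.symm h₂) (P.iso_closed e₃.symm h₃))
  ext_mem T hT h₁ h₂ X hX := by
    obtain ⟨T', hT', ⟨e₁⟩, ⟨e₂⟩, ⟨e₃⟩⟩ := (hC X T hT).1
    exact P.iso_closed e₃ (P.ext_mem T' hT' (P.iso_closed e₁.symm (h₁ X hX))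
      (P.iso_closed e₂.symm (h₂ X hX)))
  retract_mem i r hir h X hX :=
    P.retract_mem (X ◁ i) (X ◁ r) (by rw [← whiskerLeft_comp, hir, whiskerLeft_id]) (h X hX)
  tensor_right_mem Y Z h X hX := P.iso_closed (α_ X Y Z) (P.tensor_right_mem _ _ (h X hX))
  tensor_left_mem Z Y h X hX := P.iso_closed (α_ X Z Y) (h _ (hS X Z hX))

/-- A prime thick ideal is completely prime with respect to an object commuting, up to
isomorphism, with all objects. -/
theorem ThickIdeal.IsPrime.mem_or_mem_of_central (hC : TensorExact C) {P : ThickIdeal C}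
    (hP : P.IsPrime) {A B : C} (hA : ∀ X : C, Nonempty (A ⊗ X ≅ X ⊗ A)) (h : P.mem (A ⊗ B)) :
    P.mem A ∨ P.mem B := by
  let J := rightAnnihilator hC P (fun X => ∃ Z : C, Nonempty (X ≅ A ⊗ Z)) <| by
    rintro X Y ⟨Z, ⟨e⟩⟩
    exact ⟨Z ⊗ Y, ⟨whiskerRightIso e Y ≪≫ α_ A Z Y⟩⟩
  let I := leftAnnihilator hC P J.mem J.tensor_left_mem
  refine (hP.2 I J fun X Y hX hY => hX Y hY).imp (fun hI => hI A ?_) (fun hJ => hJ B ?_)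
  · exact fun Y hY => hY A ⟨𝟙_ C, ⟨(ρ_ A).symm⟩⟩
  · rintro X ⟨Z, ⟨e⟩⟩
    obtain ⟨c⟩ := hA Z
    exact P.iso_closed (whiskerRightIso (e ≪≫ c) B ≪≫ α_ Z A B).symm (P.tensor_left_mem Z _ h)

end MonoidalTriangulated

/-- The image in a stable category of an object of the Drinfeld center commutes, up to
isomorphism, with every object. -/
theorem StableCategoryData.central {A : Type*} [Category.{v} A] [MonoidalCategory A]
    [Limits.HasZeroMorphisms A]
    {S : Type u} [Category.{v} S] [HasZeroObject S] [Preadditive S] [MonoidalCategory S]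
    [HasShift S ℤ] [∀ n : ℤ, (shiftFunctor S n).Additive] [Pretriangulated S]
    (G : StableCategoryData A S) (Z : Center A) (X : S) :
    Nonempty (G.Gq.obj Z.1 ⊗ X ≅ X ⊗ G.Gq.obj Z.1) := by
  obtain ⟨Y, rfl⟩ := G.obj_surj X
  obtain ⟨e⟩ := G.tensor_iso Z.1 Y
  obtain ⟨e'⟩ := G.tensor_iso Y Z.1
  exact ⟨e.symm ≪≫ G.Gq.mapIso (Z.2.β Y) ≪≫ e'⟩

/-- Proposition `support-datum`.
Let `C` be a finite tensor category.  The map `W` defined on objects of `st(Z(C))` by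
`W(X) = V(F̄(X)) = {P ∈ Spc st(C) : F̄(X) ∉ P}` is a support datum on `st(Z(C))` with values
in the topological space `Spc st(C)`, and each `W(X)` is a closed subset of `Spc st(C)`. -/
theorem balmer_spectra_drinfeld_centers_statement_3
    (k : Type u) [Field k]
    -- `C` is a finite tensor category over `k`:
    (C : Type u) [Category.{v} C] [Abelian C] [Linear k C]
    [MonoidalCategory C] [MonoidalPreadditive C] [MonoidalLinear k C]
    [RigidCategory C] [EnoughProjectives C]
    [∀ X Y : C, Module.Finite k (X ⟶ Y)]
    (hunit : Module.finrank k (𝟙_ C ⟶ 𝟙_ C) = 1)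
    (hlen : ∀ X : C, WellFoundedLT (Subobject X) ∧ WellFoundedGT (Subobject X))
    (hsimples : ∃ (ι : Type) (_ : Finite ι) (s : ι → C),
      ∀ X : C, Simple X → ∃ i, Nonempty (X ≅ s i))
    -- the Drinfeld center `Z(C) = Center C` (a finite tensor category by Etingof–Ostrik):
    [Limits.HasZeroMorphisms (Center C)] [Abelian (Center C)] [EnoughProjectives (Center C)]
    [PreservesFiniteLimits (Center.forget C)] [PreservesFiniteColimits (Center.forget C)]
    -- the stable categories `st(C)` and `st(Z(C))`:
    (SC : Type u) [Category.{v} SC] [HasZeroObject SC] [Preadditive SC] [MonoidalCategory SC]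
    [HasShift SC ℤ] [∀ n : ℤ, (shiftFunctor SC n).Additive] [Pretriangulated SC]
    (hSC : TensorExact SC) (GC : StableCategoryData C SC)
    (SZ : Type u) [Category.{v} SZ] [HasZeroObject SZ] [Preadditive SZ] [MonoidalCategory SZ]
    [HasShift SZ ℤ] [∀ n : ℤ, (shiftFunctor SZ n).Additive] [Pretriangulated SZ]
    [HasBinaryBiproducts SZ]
    (hSZ : TensorExact SZ) (GZ : StableCategoryData (Center C) SZ)
    -- `F̄ : st(Z(C)) → st(C)` is the monoidal triangulated functor induced by the
    -- forgetful functor `F : Z(C) → C` (Statement 1):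
    (Fbar : MTFunctor SZ SC)
    (hFbar : GZ.Gq ⋙ Fbar.toFun = Center.forget C ⋙ GC.Gq)
    -- the support `W(X) = V_C(F̄ X) ⊆ Spc st(C)`:
    (W : SZ → Set (Spc SC))
    (hW : ∀ X : SZ, W X = {P : Spc SC | ¬ P.1.mem (Fbar.toFun.obj X)}) :
    -- `W` is a support datum with closed values:
    (W 0 = ∅) ∧
    (W (𝟙_ SZ) = Set.univ) ∧
    (∀ A B : SZ, W (A ⊞ B) = W A ∪ W B) ∧
    (∀ A : SZ, W (A⟦(1 : ℤ)⟧) = W A) ∧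
    (∀ T : Triangle SZ, T ∈ (distTriang SZ) → W T.obj₁ ⊆ W T.obj₂ ∪ W T.obj₃) ∧
    (∀ A B : SZ, (⋃ Z : SZ, W (A ⊗ Z ⊗ B)) = W A ∩ W B) ∧
    (∀ A : SZ, IsClosed (W A)) := by
  have hcentral (A : SZ) (X : SC) :
      Nonempty (Fbar.toFun.obj A ⊗ X ≅ X ⊗ Fbar.toFun.obj A) := by
    obtain ⟨Z, rfl⟩ := GZ.obj_surj A
    have hZ : Fbar.toFun.obj (GZ.Gq.obj Z) = GC.Gq.obj Z.1 := Functor.congr_obj hFbar Z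
    rw [hZ]
    exact GC.central Z X
  have mem_W (A : SZ) (P : Spc SC) : P ∈ W A ↔ ¬ P.1.mem (Fbar.toFun.obj A) := by
    rw [hW]; rfl
  refine ⟨?_, ?_, fun A B => ?_, fun A => ?_, fun T hT P => ?_, fun A B => ?_, fun A => ?_⟩
  · refine Set.eq_empty_of_forall_notMem fun P hP => ?_
    exact (mem_W _ P).1 hP (P.1.mem_of_isZero Fbar.zero_iso)
  · refine Set.eq_univ_of_forall fun P => (mem_W _ P).2 fun h => ?_
    obtain ⟨e⟩ := Fbar.unit_iso
    exact P.1.unit_notMem P.2 (P.1.iso_closed e h)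
  · ext P
    rw [Set.mem_union, mem_W, mem_W, mem_W, ← not_and_or, not_iff_not]
    refine ⟨fun h => ⟨?_, ?_⟩, fun ⟨hA, hB⟩ => ?_⟩
    · exact P.1.retract_mem (Fbar.toFun.map biprod.inl) (Fbar.toFun.map biprod.fst)
        (by rw [← Functor.map_comp, biprod.inl_fst, CategoryTheory.Functor.map_id]) h
    · exact P.1.retract_mem (Fbar.toFun.map biprod.inr) (Fbar.toFun.map biprod.snd)
        (by rw [← Functor.map_comp, biprod.inr_snd, CategoryTheory.Functor.map_id]) h
    · obtain ⟨T', hT', ⟨e₁⟩, ⟨e₂⟩, ⟨e₃⟩⟩ :=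
        Fbar.maps_dist _ (binaryBiproductTriangle_distinguished A B)
      exact P.1.iso_closed e₂ (P.1.mem_obj₂ T' hT' (P.1.iso_closed e₁.symm hA)
        (P.1.iso_closed e₃.symm hB))
  · ext P
    obtain ⟨e⟩ := Fbar.shift_iso A 1
    rw [mem_W, mem_W, P.1.mem_congr e, P.1.shift_mem_iff]
  · rw [Set.mem_union, mem_W, mem_W, mem_W, ← not_and_or, not_imp_not]
    rintro ⟨h₂, h₃⟩
    obtain ⟨T', hT', ⟨e₁⟩, ⟨e₂⟩, ⟨e₃⟩⟩ := Fbar.maps_dist T hT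
    exact P.1.iso_closed e₁ (P.1.mem_obj₁ T' hT' (P.1.iso_closed e₂.symm h₂)
      (P.1.iso_closed e₃.symm h₃))
  · ext P
    simp only [Set.mem_iUnion, Set.mem_inter_iff, mem_W]
    constructor
    · rintro ⟨Z, hZ⟩
      obtain ⟨e⟩ := Fbar.tensor_iso A (Z ⊗ B)
      obtain ⟨e'⟩ := Fbar.tensor_iso Z B
      rw [P.1.mem_congr e] at hZ
      exact ⟨fun h => hZ (P.1.tensor_right_mem _ _ h), fun h => hZ (P.1.tensor_left_mem _ _
        (P.1.iso_closed e'.symm (P.1.tensor_left_mem _ _ h)))⟩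
    · rintro ⟨hA, hB⟩
      obtain ⟨e⟩ := Fbar.tensor_iso A B
      refine ⟨𝟙_ SZ, fun h => ?_⟩
      have hAB : P.1.mem (Fbar.toFun.obj A ⊗ Fbar.toFun.obj B) :=
        P.1.iso_closed (Fbar.toFun.mapIso (whiskerLeftIso A (λ_ B)) ≪≫ e) h
      exact (P.2.mem_or_mem_of_central hSC (hcentral A) hAB).elim hA hB
  · rw [hW, ← isOpen_compl_iff]
    refine TopologicalSpace.isOpen_generateFrom_of_mem ⟨Fbar.toFun.obj A, ?_⟩
    ext P
    simp

end TTG
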